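/- arXiv:2512.08119 — 5 statements merged into one kernel-verified Lean document; each statement's English description precedes it below -/
import Mathlib

section
/- Let a₁,a₂,a₃,a₄ ∈ ℂ and n ∈ ℤ≥0, and set b₁ = a₁+a₂+a₃+a₄. For j ∈ {1,2} and m ∈ ℕ define r_j(m) = i^m · (n!/(n+m)!) · (a_j+a₃+n)_m (a_j+a₄+n)_m, and for j ∈ {3,4} define r_j(m) = (−i)^m · (n!/(n+m)!) · (a_j+a₁+n)_m (a_j+a₂+n)_m. Then the 4×4 determinant whose (j,k) entry is r_j(k−1) equals (a₁−a₂)(a₃−a₄) · ∏_{j∈{1,2}, k∈{3,4}} (a_j+a_k+n) · (b₁+2n)_3 (b₁+2n+2)_3 / ((n+1)_3 (n+1)_2 (n+1)_1). -/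
open Complex Finset

/-- Rising Pochhammer symbol `(x)_m = x (x+1) ⋯ (x+m-1)`. -/
noncomputable def poch (x : ℂ) (m : ℕ) : ℂ := ∏ j ∈ Finset.range m, (x + j)

/-- The ratio `r_j(m) = p̌_{n+m}(x_j)/p̌_n(x_j)` for the continuous Hahn family,
at the points `x_j = i a_j` (j = 1,2) and `x_j = -i a_j` (j = 3,4). -/
noncomputable def cHRatio (a₁ a₂ a₃ a₄ : ℂ) (n : ℕ) (j : Fin 4) (m : ℕ) : ℂ :=
  (if (j : ℕ) < 2 then Complex.I else -Complex.I) ^ m *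
    ((n.factorial : ℂ) / ((n + m).factorial : ℂ)) *
    (if (j : ℕ) < 2
      then poch (![a₁, a₂, a₃, a₄] j + a₃ + n) m * poch (![a₁, a₂, a₃, a₄] j + a₄ + n) m
      else poch (![a₁, a₂, a₃, a₄] j + a₁ + n) m * poch (![a₁, a₂, a₃, a₄] j + a₂ + n) m)

/-- The polynomial identity, in the three variables `x = a + c`, `y = a + d`, `z = b + c`. -/
lemma cH_poly3 (x y z w s : ℂ) (hw : w = y + z - x) (hs : s = y + z) :
    Matrix.det !![1, x*y, x*y*((x+1)*(y+1)), x*y*((x+1)*(y+1))*((x+2)*(y+2));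
      1, z*w, z*w*((z+1)*(w+1)), z*w*((z+1)*(w+1))*((z+2)*(w+2));
      1, -(x*z), x*z*((x+1)*(z+1)), -(x*z*((x+1)*(z+1))*((x+2)*(z+2)));
      1, -(y*w), y*w*((y+1)*(w+1)), -(y*w*((y+1)*(w+1))*((y+2)*(w+2)))]
    = -((x - z) * (x - y) * (x*y*z*w) * (s*(s+1)*(s+2)*((s+2)*(s+3)*(s+4)))) := by
  subst hw hs
  simp [Matrix.det_succ_row_zero, Fin.sum_univ_succ, Fin.succAbove]
  ring

lemma cH_poly (a b c d : ℂ)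
    (M : Matrix (Fin 4) (Fin 4) ℂ)
    (hM : M = !![1, (a+c)*(a+d), (a+c)*(a+d)*((a+c+1)*(a+d+1)), (a+c)*(a+d)*((a+c+1)*(a+d+1))*((a+c+2)*(a+d+2));
      1, (b+c)*(b+d), (b+c)*(b+d)*((b+c+1)*(b+d+1)), (b+c)*(b+d)*((b+c+1)*(b+d+1))*((b+c+2)*(b+d+2));
      1, -((a+c)*(b+c)), (a+c)*(b+c)*((a+c+1)*(b+c+1)), -((a+c)*(b+c)*((a+c+1)*(b+c+1))*((a+c+2)*(b+c+2)));
      1, -((a+d)*(b+d)), (a+d)*(b+d)*((a+d+1)*(b+d+1)), -((a+d)*(b+d)*((a+d+1)*(b+d+1))*((a+d+2)*(b+d+2)))]) :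
    M.det = -((a - b) * (c - d) * ((a+c)*(a+d)*(b+c)*(b+d)) *
      ((a+b+c+d)*(a+b+c+d+1)*(a+b+c+d+2)*((a+b+c+d+2)*(a+b+c+d+3)*(a+b+c+d+4)))) := by
  subst hM
  rw [cH_poly3 (a+c) (a+d) (b+c) (b+d) (a+b+c+d) (by ring) (by ring)]
  rw [add_sub_add_right_eq_sub, add_sub_add_left_eq_sub]

/-- The determinant `D_n^{(0,1,2,3)}` for the continuous Hahn family. -/
theorem continuous_hahn_D_matrix_det
    (a₁ a₂ a₃ a₄ : ℂ) (n : ℕ) :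
    Matrix.det (Matrix.of fun j k : Fin 4 => cHRatio a₁ a₂ a₃ a₄ n j k.val)
    = (a₁ - a₂) * (a₃ - a₄) *
        ((a₁ + a₃ + n) * (a₁ + a₄ + n) * (a₂ + a₃ + n) * (a₂ + a₄ + n)) *
        (poch (a₁ + a₂ + a₃ + a₄ + 2 * n) 3 * poch (a₁ + a₂ + a₃ + a₄ + 2 * n + 2) 3) /
        (poch ((n : ℂ) + 1) 3 * poch ((n : ℂ) + 1) 2 * poch ((n : ℂ) + 1) 1) := by
  have hN : (Matrix.of fun j k : Fin 4 => cHRatio a₁ a₂ a₃ a₄ n j k.val)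
      = Matrix.of fun j k : Fin 4 =>
        (I ^ k.val * ((n.factorial : ℂ) / ((n + k.val).factorial : ℂ))) *
        (Matrix.of fun j k : Fin 4 => (if (j : ℕ) < 2 then (1 : ℂ) else -1) ^ k.val *
          (if (j : ℕ) < 2
      then poch (![a₁, a₂, a₃, a₄] j + a₃ + n) k.val * poch (![a₁, a₂, a₃, a₄] j + a₄ + n) k.val
      else poch (![a₁, a₂, a₃, a₄] j + a₁ + n) k.val * poch (![a₁, a₂, a₃, a₄] j + a₂ + n) k.val)) j k := by
    ext j k
    simp only [Matrix.of_apply, cHRatio]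
    split_ifs
    · simp only [one_pow]; ring
    · rw [neg_pow I]; ring
  rw [hN, Matrix.det_mul_row,
    cH_poly (a₁ + n / 2) (a₂ + n / 2) (a₃ + n / 2) (a₄ + n / 2)]
  · have h0 : (n.factorial : ℂ) ≠ 0 := by exact_mod_cast n.factorial_ne_zero
    have h1 : (n : ℂ) + 1 ≠ 0 := by exact_mod_cast (n.succ_ne_zero)
    have h2 : (n : ℂ) + 2 ≠ 0 := by exact_mod_cast ((n+1).succ_ne_zero)
    have h3 : (n : ℂ) + 3 ≠ 0 := by exact_mod_cast ((n+2).succ_ne_zero)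
    have f1 : ((n + 1).factorial : ℂ) = (n + 1) * n.factorial := by
      rw [Nat.factorial_succ]; push_cast; ring
    have f2 : ((n + 2).factorial : ℂ) = (n + 2) * ((n + 1) * n.factorial) := by
      rw [Nat.factorial_succ, Nat.cast_mul, f1]; push_cast; ring
    have f3 : ((n + 3).factorial : ℂ) = (n + 3) * ((n + 2) * ((n + 1) * n.factorial)) := by
      rw [Nat.factorial_succ, Nat.cast_mul, f2]; push_cast; ring
    have hv : (∏ k : Fin 4, (I ^ k.val * ((n.factorial : ℂ) / ((n + k.val).factorial : ℂ))))
        = -(1 / (((n : ℂ) + 1) ^ 3 * (n + 2) ^ 2 * (n + 3))) := by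
      rw [Fin.prod_univ_four]
      change (I ^ 0 * ((n.factorial : ℂ) / (n.factorial : ℂ))) *
        (I ^ 1 * ((n.factorial : ℂ) / ((n + 1).factorial : ℂ))) *
        (I ^ 2 * ((n.factorial : ℂ) / ((n + 2).factorial : ℂ))) *
        (I ^ 3 * ((n.factorial : ℂ) / ((n + 3).factorial : ℂ))) = _
      rw [f1, f2, f3, I_pow_three, I_sq]
      field_simp
      rw [I_sq]
    have hd : poch ((n : ℂ) + 1) 3 * poch ((n : ℂ) + 1) 2 * poch ((n : ℂ) + 1) 1
        = ((n : ℂ) + 1) ^ 3 * (n + 2) ^ 2 * (n + 3) := by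
      simp only [poch, Finset.prod_range_succ, Finset.prod_range_zero]
      push_cast; ring
    have hp : ∀ x : ℂ, poch x 3 = x * (x + 1) * (x + 2) := by
      intro x
      simp only [poch, Finset.prod_range_succ, Finset.prod_range_zero]
      push_cast; ring
    rw [hv, hd, hp, hp, neg_mul_neg, one_div, mul_comm, ← div_eq_mul_inv]
    congr 1
    have e : ∀ x y : ℂ, x + n / 2 + (y + n / 2) = x + y + n := by intros; ring
    have e' : a₁ + n / 2 + (a₂ + n / 2) + (a₃ + n / 2) + (a₄ + n / 2)
      = a₁ + a₂ + a₃ + a₄ + 2 * n := by ring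
    rw [e', e, e, e, e, add_sub_add_right_eq_sub, add_sub_add_right_eq_sub]
    generalize a₁ + a₂ + a₃ + a₄ + 2 * (n : ℂ) = s
    have e1 : s + 2 + 1 = s + 3 := by ring
    have e2 : s + 2 + 2 = s + 4 := by ring
    rw [e1, e2]
  · ext j k
    fin_cases j <;> fin_cases k <;>
      simp [poch, Finset.prod_range_succ] <;> ring
end

section
/- Let a₁,a₂,a₃,a₄ ∈ ℂ and n ∈ ℤ≥0, and set b₁ = a₁+a₂+a₃+a₄. Then the 4×4 determinant whose (j,k) entry (1 ≤ j,k ≤ 4) is ∏_{l≠j} (a_j + a_l + n)_{k−1} equals ∏_{1≤j<k≤4} (a_j − a_k)(a_j + a_k + n) · (b₁+2n)_3 (b₁+2n+2)_3. -/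
open Complex Finset

/-- The triangularity identity for `m = 1`. -/
lemma wilson_aux1 (x y z w : ℂ) :
    (y + x) * (y + z) * (y + w)
      = (x + y) * (x + z) * (x + w) + (x ^ 2 - y ^ 2) * (-(x + y + z + w)) := by
  ring

/-- The terminating summation for `m = 2`. -/
lemma wilson_aux2 (x y z w : ℂ) :
    ((y + x) * (y + x + 1)) * ((y + z) * (y + z + 1)) * ((y + w) * (y + w + 1))
      = ((x + y) * (x + y + 1)) * ((x + z) * (x + z + 1)) * ((x + w) * (x + w + 1))
        + (x ^ 2 - y ^ 2) * (-2 * (x + y + z + w + 1)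
            * ((x + y + 1) * (x + z + 1) * (x + w + 1)))
        + (x ^ 2 - y ^ 2) * ((x + 1) ^ 2 - y ^ 2)
            * ((x + y + z + w + 1) * (x + y + z + w + 2)) := by
  ring

/-- The terminating summation for `m = 3`. -/
lemma wilson_aux3 (x y z w : ℂ) :
    ((y + x) * (y + x + 1) * (y + x + 2)) * ((y + z) * (y + z + 1) * (y + z + 2))
        * ((y + w) * (y + w + 1) * (y + w + 2))
      = ((x + y) * (x + y + 1) * (x + y + 2)) * ((x + z) * (x + z + 1) * (x + z + 2))
          * ((x + w) * (x + w + 1) * (x + w + 2))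
        + (x ^ 2 - y ^ 2) * (-3 * (x + y + z + w + 2)
            * (((x + y + 1) * (x + y + 2)) * ((x + z + 1) * (x + z + 2))
              * ((x + w + 1) * (x + w + 2))))
        + (x ^ 2 - y ^ 2) * ((x + 1) ^ 2 - y ^ 2)
            * (3 * (x + y + z + w + 2) * (x + y + z + w + 3)
              * ((x + y + 2) * (x + z + 2) * (x + w + 2)))
        + (x ^ 2 - y ^ 2) * ((x + 1) ^ 2 - y ^ 2) * ((x + 2) ^ 2 - y ^ 2)
            * (-((x + y + z + w + 2) * (x + y + z + w + 3) * (x + y + z + w + 4))) := by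
  have key : ((y + z) * (y + z + 1) * (y + z + 2)) * ((y + w) * (y + w + 1) * (y + w + 2))
      = ((x + z) * (x + z + 1) * (x + z + 2)) * ((x + w) * (x + w + 1) * (x + w + 2))
        + (x - y) * (-3 * (x + y + z + w + 2)
            * (((x + z + 1) * (x + z + 2)) * ((x + w + 1) * (x + w + 2))))
        + (x - y) * (x - y + 1)
            * (3 * (x + y + z + w + 2) * (x + y + z + w + 3)
              * ((x + z + 2) * (x + w + 2)))
        + (x - y) * (x - y + 1) * (x - y + 2)
            * (-((x + y + z + w + 2) * (x + y + z + w + 3) * (x + y + z + w + 4))) := by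
    ring
  linear_combination ((x + y) * (x + y + 1) * (x + y + 2)) * key

/-- The determinant of a matrix whose columns are a triangular combination of Newton
polynomials. -/
lemma wilson_det (y : Fin 4 → ℂ) (c0 c1 c2 A0 A1 B0 B1 B2 C0 C1 C2 C3 : ℂ)
    (M : Matrix (Fin 4) (Fin 4) ℂ)
    (h0 : ∀ j, M j 0 = 1)
    (h1 : ∀ j, M j 1 = A0 + (c0 - y j) * A1)
    (h2 : ∀ j, M j 2 = B0 + (c0 - y j) * B1 + (c0 - y j) * (c1 - y j) * B2)
    (h3 : ∀ j, M j 3 = C0 + (c0 - y j) * C1 + (c0 - y j) * (c1 - y j) * C2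
      + (c0 - y j) * (c1 - y j) * (c2 - y j) * C3) :
    M.det = (y 0 - y 1) * (y 0 - y 2) * (y 0 - y 3) * (y 1 - y 2) * (y 1 - y 3) * (y 2 - y 3)
      * (A1 * B2 * C3) := by
  have hM : M = (Matrix.of fun j => ![1, c0 - y j, (c0 - y j) * (c1 - y j),
        (c0 - y j) * (c1 - y j) * (c2 - y j)]) *
      !![1, A0, B0, C0; 0, A1, B1, C1; 0, 0, B2, C2; 0, 0, 0, C3] := by
    ext j k
    fin_cases k
    · simp [Matrix.mul_apply, Fin.sum_univ_four, h0]
    · simp [Matrix.mul_apply, Fin.sum_univ_four, h1]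
    · simp [Matrix.mul_apply, Fin.sum_univ_four, h2]
    · simp [Matrix.mul_apply, Fin.sum_univ_four, h3]
  have hC : (!![1, A0, B0, C0; 0, A1, B1, C1; 0, 0, B2, C2; 0, 0, 0, C3]
      : Matrix (Fin 4) (Fin 4) ℂ).det = A1 * B2 * C3 := by
    simp [Matrix.det_succ_row_zero, Fin.sum_univ_succ, Fin.succAbove]
    try ring
  rw [hM, Matrix.det_mul, hC]
  congr 1
  simp [Matrix.det_succ_row_zero, Fin.sum_univ_succ, Fin.succAbove]
  ring

theorem wilson_D_matrix_det (a : Fin 4 → ℂ) (n : ℕ) :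
    Matrix.det (Matrix.of fun j k : Fin 4 =>
      ∏ l ∈ Finset.univ.erase j, poch (a j + a l + n) k.val)
    = (∏ p ∈ Finset.univ.filter (fun p : Fin 4 × Fin 4 => p.1 < p.2),
          ((a p.1 - a p.2) * (a p.1 + a p.2 + n))) *
        (poch (a 0 + a 1 + a 2 + a 3 + 2 * n) 3 * poch (a 0 + a 1 + a 2 + a 3 + 2 * n + 2) 3) := by
  obtain ⟨x, hx⟩ : ∃ x : Fin 4 → ℂ, ∀ j, a j = x j - n / 2 :=
    ⟨fun j => a j + n / 2, fun j => by ring⟩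
  have p0 : ∀ t, poch t 0 = 1 := fun t => by simp [poch]
  have p1 : ∀ t, poch t 1 = t := fun t => by simp [poch]
  have p2 : ∀ t, poch t 2 = t * (t + 1) := fun t => by simp [poch, Finset.prod_range_succ]
  have p3 : ∀ t, poch t 3 = t * (t + 1) * (t + 2) := fun t => by
    simp [poch, Finset.prod_range_succ]
  have hs : ∀ j l, a j + a l + n = x j + x l := fun j l => by rw [hx, hx]; ring
  have hd : ∀ j l, a j - a l = x j - x l := fun j l => by rw [hx, hx]; ring
  have hb : a 0 + a 1 + a 2 + a 3 + 2 * n = x 0 + x 1 + x 2 + x 3 := by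
    rw [hx, hx, hx, hx]; ring
  have e0 : (Finset.univ.erase (0 : Fin 4)) = {1, 2, 3} := by decide
  have e1 : (Finset.univ.erase (1 : Fin 4)) = {0, 2, 3} := by decide
  have e2 : (Finset.univ.erase (2 : Fin 4)) = {0, 1, 3} := by decide
  have e3 : (Finset.univ.erase (3 : Fin 4)) = {0, 1, 2} := by decide
  have ef : (Finset.univ.filter (fun p : Fin 4 × Fin 4 => p.1 < p.2))
      = {(0, 1), (0, 2), (0, 3), (1, 2), (1, 3), (2, 3)} := by decide
  have q : ∀ (f : Fin 4 → ℂ),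
      (∏ l ∈ ({1, 2, 3} : Finset (Fin 4)), f l = f 1 * f 2 * f 3) ∧
      (∏ l ∈ ({0, 2, 3} : Finset (Fin 4)), f l = f 0 * f 2 * f 3) ∧
      (∏ l ∈ ({0, 1, 3} : Finset (Fin 4)), f l = f 0 * f 1 * f 3) ∧
      (∏ l ∈ ({0, 1, 2} : Finset (Fin 4)), f l = f 0 * f 1 * f 2) := fun f => by
    refine ⟨?_, ?_, ?_, ?_⟩ <;> simp [mul_assoc]
  have hr : (∏ p ∈ Finset.univ.filter (fun p : Fin 4 × Fin 4 => p.1 < p.2),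
          ((a p.1 - a p.2) * (a p.1 + a p.2 + n)))
      = (x 0 ^ 2 - x 1 ^ 2) * (x 0 ^ 2 - x 2 ^ 2) * (x 0 ^ 2 - x 3 ^ 2) * (x 1 ^ 2 - x 2 ^ 2)
        * (x 1 ^ 2 - x 3 ^ 2) * (x 2 ^ 2 - x 3 ^ 2) := by
    simp only [hs, hd, ef]
    simp
    ring
  rw [hr, hb, p3, p3]
  simp only [hs]
  rw [wilson_det (fun j => x j ^ 2) (x 0 ^ 2) ((x 0 + 1) ^ 2) ((x 0 + 2) ^ 2)
    ((x 0 + x 1) * (x 0 + x 2) * (x 0 + x 3))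
    (-(x 0 + x 1 + x 2 + x 3))
    (((x 0 + x 1) * (x 0 + x 1 + 1)) * ((x 0 + x 2) * (x 0 + x 2 + 1))
      * ((x 0 + x 3) * (x 0 + x 3 + 1)))
    (-2 * (x 0 + x 1 + x 2 + x 3 + 1) * ((x 0 + x 1 + 1) * (x 0 + x 2 + 1) * (x 0 + x 3 + 1)))
    ((x 0 + x 1 + x 2 + x 3 + 1) * (x 0 + x 1 + x 2 + x 3 + 2))
    (((x 0 + x 1) * (x 0 + x 1 + 1) * (x 0 + x 1 + 2))
      * ((x 0 + x 2) * (x 0 + x 2 + 1) * (x 0 + x 2 + 2))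
      * ((x 0 + x 3) * (x 0 + x 3 + 1) * (x 0 + x 3 + 2)))
    (-3 * (x 0 + x 1 + x 2 + x 3 + 2) * (((x 0 + x 1 + 1) * (x 0 + x 1 + 2))
      * ((x 0 + x 2 + 1) * (x 0 + x 2 + 2)) * ((x 0 + x 3 + 1) * (x 0 + x 3 + 2))))
    (3 * (x 0 + x 1 + x 2 + x 3 + 2) * (x 0 + x 1 + x 2 + x 3 + 3)
      * ((x 0 + x 1 + 2) * (x 0 + x 2 + 2) * (x 0 + x 3 + 2)))
    (-((x 0 + x 1 + x 2 + x 3 + 2) * (x 0 + x 1 + x 2 + x 3 + 3) * (x 0 + x 1 + x 2 + x 3 + 4)))]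
  · generalize x 0 + x 1 + x 2 + x 3 = s
    rw [mul_assoc _ _ (_ * (_ * _ * _)), mul_assoc]
    simp only [mul_assoc]
    congr 6
    ring
  · intro j
    simp [p0]
  · intro j
    simp only [Matrix.of_apply, Fin.val_one, p1]
    fin_cases j
    · simp [e0, (q _).1]
    · simp only [Fin.mk_one, e1, (q _).2.1]
      linear_combination wilson_aux1 (x 0) (x 1) (x 2) (x 3)
    · simp only [Fin.reduceFinMk, e2, (q _).2.2.1]
      linear_combination wilson_aux1 (x 0) (x 2) (x 1) (x 3)
    · simp only [Fin.reduceFinMk, e3, (q _).2.2.2]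
      linear_combination wilson_aux1 (x 0) (x 3) (x 1) (x 2)
  · intro j
    simp only [Matrix.of_apply, Fin.val_two, p2]
    fin_cases j
    · simp [e0, (q _).1]
    · simp only [Fin.mk_one, e1, (q _).2.1]
      linear_combination wilson_aux2 (x 0) (x 1) (x 2) (x 3)
    · simp only [Fin.reduceFinMk, e2, (q _).2.2.1]
      linear_combination wilson_aux2 (x 0) (x 2) (x 1) (x 3)
    · simp only [Fin.reduceFinMk, e3, (q _).2.2.2]
      linear_combination wilson_aux2 (x 0) (x 3) (x 1) (x 2)
  · intro j
    have v3 : (3 : Fin 4).val = 3 := rfl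
    simp only [Matrix.of_apply, v3, p3]
    fin_cases j
    · simp [e0, (q _).1]
    · simp only [Fin.mk_one, e1, (q _).2.1]
      linear_combination wilson_aux3 (x 0) (x 1) (x 2) (x 3)
    · simp only [Fin.reduceFinMk, e2, (q _).2.2.1]
      linear_combination wilson_aux3 (x 0) (x 2) (x 1) (x 3)
    · simp only [Fin.reduceFinMk, e3, (q _).2.2.2]
      linear_combination wilson_aux3 (x 0) (x 3) (x 1) (x 2)
end

section
/- Let a₁,a₂,a₃ ∈ ℂ and n ∈ ℤ≥0, and set b₁ = a₁+a₂+a₃ and b₂ = a₁a₂+a₁a₃+a₂a₃. Then for all η ∈ ℂ: (a₁²+η)(a₂²+η)(a₃²+η) · S_n(η; a₁+1, a₂+1, a₃+1) = −[ S_{n+3}(η; a₁,a₂,a₃) + α_{n,2} S_{n+2}(η; a₁,a₂,a₃) + α_{n,1} S_{n+1}(η; a₁,a₂,a₃) + α_{n,0} S_n(η; a₁,a₂,a₃) ], where α_{n,2} = −( b₂ + (b₁+n)(b₁+n+1) + (2n+5)(b₁+n+1) + n + 2 ), α_{n,1} = (2b₁ + 3(n+1)) · ∏_{1≤j<k≤3}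 (a_j+a_k+n+1), and α_{n,0} = −∏_{1≤j<k≤3} (a_j+a_k+n)(a_j+a_k+n+1). -/
open Complex Finset

/-- Continuous dual Hahn polynomial `S_n(η; a₁,a₂,a₃)` in the variable `η`
(for `η = x²` it is the standard `S_n(x²;a₁,a₂,a₃)`). -/
noncomputable def cdHPoly (a₁ a₂ a₃ : ℂ) (n : ℕ) (η : ℂ) : ℂ :=
  ∑ k ∈ Finset.range (n + 1),
    poch (-(n : ℂ)) k / (k.factorial : ℂ) *
      (∏ j ∈ Finset.range k, ((a₁ + j) ^ 2 + η)) *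
      poch (a₁ + a₂ + k) (n - k) * poch (a₁ + a₃ + k) (n - k)

lemma poch_succ (x : ℂ) (m : ℕ) : poch x (m + 1) = poch x m * (x + m) := by
  simp [poch, Finset.prod_range_succ]

lemma poch_zero (x : ℂ) : poch x 0 = 1 := by simp [poch]

lemma poch_succ_left (x : ℂ) (m : ℕ) : poch x (m + 1) = x * poch (x + 1) m := by
  simp only [poch, Finset.prod_range_succ']
  rw [mul_comm]
  simp only [Nat.cast_zero, add_zero]
  congr 1
  apply Finset.prod_congr rfl
  intro j _
  push_cast
  ring

lemma poch_neg (n k : ℕ) :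
    poch (-(n : ℂ)) k / (k.factorial : ℂ) = (-1) ^ k * (n.choose k : ℂ) := by
  have hk : (k.factorial : ℂ) ≠ 0 := by exact_mod_cast k.factorial_ne_zero
  rw [div_eq_iff hk]
  clear hk
  induction k with
  | zero => simp [poch]
  | succ k ih =>
    rw [poch_succ, ih, Nat.factorial_succ]
    by_cases h : k ≤ n
    · have h1 : ((n.choose (k + 1) : ℂ)) * (k + 1) = n.choose k * (n - k) := by
        have := Nat.choose_succ_right_eq n k
        rw [← Nat.cast_sub h]
        exact_mod_cast this
      push_cast
      linear_combination ((-1) ^ k * (k.factorial : ℂ)) * h1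
    · rw [Nat.choose_eq_zero_of_lt (by omega : n < k),
        Nat.choose_eq_zero_of_lt (by omega : n < k + 1)]
      simp

/-- the basis in which everything is expanded -/
noncomputable def phiB (a η : ℂ) (k : ℕ) : ℂ := ∏ j ∈ Finset.range k, ((a + j) ^ 2 + η)

lemma phiB_succ (a η : ℂ) (k : ℕ) :
    phiB a η (k + 1) = phiB a η k * ((a + k) ^ 2 + η) := by
  simp [phiB, Finset.prod_range_succ]

lemma phiB_succ_left (a η : ℂ) (k : ℕ) :
    phiB a η (k + 1) = (a ^ 2 + η) * phiB (a + 1) η k := by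
  simp only [phiB, Finset.prod_range_succ']
  rw [mul_comm]
  simp only [Nat.cast_zero, add_zero]
  congr 1
  apply Finset.prod_congr rfl
  intro j _
  push_cast
  ring

/-- coefficients -/
noncomputable def cf (x y : ℂ) (n k : ℕ) : ℂ :=
  (-1) ^ k * (n.choose k : ℂ) * poch (x + k) (n - k) * poch (y + k) (n - k)

lemma cdH_eq (a b c : ℂ) (n r : ℕ) (η : ℂ) :
    cdHPoly a b c n η = ∑ k ∈ range (n + 1 + r), cf (a + b) (a + c) n k * phiB a η k := by
  rw [Finset.sum_range_add]
  have : ∑ x ∈ range r, cf (a + b) (a + c) n (n + 1 + x) * phiB a η (n + 1 + x) = 0 := by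
    apply Finset.sum_eq_zero
    intro x _
    simp [cf, Nat.choose_eq_zero_of_lt (by omega : n < n + 1 + x)]
  rw [this, add_zero, cdHPoly]
  apply Finset.sum_congr rfl
  intro k _
  rw [poch_neg, cf, phiB]
  ring

/-- shifted binomials -/
def bsh (i n k : ℕ) : ℕ := if i ≤ k then n.choose (k - i) else 0

lemma sum_shift (i N r : ℕ) (G : ℕ → ℂ) (h0 : ∀ j < i, G j = 0) (h1 : ∀ j, i + N ≤ j → G j = 0) :
    ∑ j ∈ range (i + N + r), G j = ∑ k ∈ range N, G (i + k) := by
  rw [Finset.sum_range_add, Finset.sum_range_add, Finset.sum_eq_zero (s := range i),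
    Finset.sum_eq_zero (s := range r)]
  · simp
  · intro x _
    exact h1 _ (by omega)
  · intro x hx
    exact h0 _ (by simpa using hx)

lemma bsh_formula (n k m : ℕ) (h : k + m = n + 3) :
    (bsh 0 n k : ℂ) = m * (m - 1) * (m - 2) * (n.factorial / (k.factorial * m.factorial)) ∧
    (bsh 1 n k : ℂ) = k * m * (m - 1) * (n.factorial / (k.factorial * m.factorial)) ∧
    (bsh 2 n k : ℂ) = k * (k - 1) * m * (n.factorial / (k.factorial * m.factorial)) ∧
    (bsh 3 n k : ℂ) = k * (k - 1) * (k - 2) * (n.factorial / (k.factorial * m.factorial)) := by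
  have hf : ∀ p : ℕ, (p.factorial : ℂ) ≠ 0 := fun p => by exact_mod_cast p.factorial_ne_zero
  have hs : ∀ p : ℕ, (p : ℂ) + 1 ≠ 0 := fun p => by exact_mod_cast p.succ_ne_zero
  have hs2 : ∀ p : ℕ, (p : ℂ) + 1 + 1 ≠ 0 := fun p => by exact_mod_cast (p+1).succ_ne_zero
  have hs3 : ∀ p : ℕ, (p : ℂ) + 3 ≠ 0 := fun p => by
    exact_mod_cast (p+1+1).succ_ne_zero
  refine ⟨?_, ?_, ?_, ?_⟩
  · rcases m with _ | _ | _ | m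
    · simp [bsh, Nat.choose_eq_zero_of_lt (by omega : n < k)]
    · simp [bsh, Nat.choose_eq_zero_of_lt (by omega : n < k)]
    · simp [bsh, Nat.choose_eq_zero_of_lt (by omega : n < k)]
    · obtain rfl : n = k + m := by omega
      have e' : ((m + 1 + 1 + 1 : ℕ) : ℂ) = m + 3 := by
        push_cast
        ring
      have e : ((m + 1 + 1 + 1).factorial : ℂ) = (m + 3) * (m + 2) * (m + 1) * m.factorial := by
        simp only [Nat.factorial_succ]
        push_cast
        ring
      simp only [bsh, Nat.zero_le, if_true, Nat.sub_zero, Nat.cast_add_choose ℂ]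
      have h3 := hs3 m
      have h2 : (m : ℂ) + 2 ≠ 0 := by
        have := hs2 m
        rwa [add_assoc, one_add_one_eq_two] at this
      have h1 := hs m
      have f1 := hf k
      have f2 := hf m
      rw [e, e']
      field_simp
      ring
  · rcases k with _ | k
    · simp [bsh]
    rcases m with _ | _ | m
    · simp [bsh, Nat.choose_eq_zero_of_lt (by omega : n < k)]
    · simp [bsh, Nat.choose_eq_zero_of_lt (by omega : n < k)]
    · obtain rfl : n = k + m := by omega
      simp only [bsh, Nat.le_add_left, if_true, Nat.add_sub_cancel, Nat.cast_add_choose ℂ,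
        Nat.factorial_succ]
      push_cast
      field_simp [hf, hs m, hs2 m, hs k]
      ring
  · rcases k with _ | _ | k
    · simp [bsh]
    · simp [bsh]
    rcases m with _ | m
    · simp [bsh, Nat.choose_eq_zero_of_lt (by omega : n < k)]
    · obtain rfl : n = k + m := by omega
      simp only [bsh, show 2 ≤ k + 1 + 1 by omega, if_true, show k + 1 + 1 - 2 = k by omega,
        Nat.cast_add_choose ℂ, Nat.factorial_succ]
      push_cast
      field_simp [hf, hs m, hs k, hs2 k]
      ring
  · rcases k with _ | _ | _ | k
    · simp [bsh]
    · simp [bsh]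
    · simp [bsh]
    · obtain rfl : n = k + m := by omega
      have e' : ((k + 1 + 1 + 1 : ℕ) : ℂ) = k + 3 := by
        push_cast
        ring
      have e : ((k + 1 + 1 + 1).factorial : ℂ) = (k + 3) * (k + 2) * (k + 1) * k.factorial := by
        simp only [Nat.factorial_succ]
        push_cast
        ring
      simp only [bsh, show 3 ≤ k + 1 + 1 + 1 by omega, if_true,
        show k + 1 + 1 + 1 - 3 = k by omega,
        Nat.cast_add_choose ℂ]
      have h3 := hs3 k
      have h2 : (k : ℂ) + 2 ≠ 0 := by
        have := hs2 k
        rwa [add_assoc, one_add_one_eq_two] at this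
      have h1 := hs k
      have f1 := hf k
      have f2 := hf m
      rw [e, e']
      field_simp
      ring

lemma choose_formula (n k m : ℕ) (h : k + m = n + 3) :
    (n.choose k : ℂ) = m * (m - 1) * (m - 2) * (n.factorial / (k.factorial * m.factorial)) ∧
    ((n + 1).choose k : ℂ) =
      (n + 1) * m * (m - 1) * (n.factorial / (k.factorial * m.factorial)) ∧
    ((n + 2).choose k : ℂ) =
      (n + 1) * (n + 2) * m * (n.factorial / (k.factorial * m.factorial)) ∧
    ((n + 3).choose k : ℂ) =
      (n + 1) * (n + 2) * (n + 3) * (n.factorial / (k.factorial * m.factorial)) := by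
  have hf : ∀ p : ℕ, (p.factorial : ℂ) ≠ 0 := fun p => by exact_mod_cast p.factorial_ne_zero
  have hs : ∀ p : ℕ, (p : ℂ) + 1 ≠ 0 := fun p => by exact_mod_cast p.succ_ne_zero
  have hs2 : ∀ p : ℕ, (p : ℂ) + 1 + 1 ≠ 0 := fun p => by exact_mod_cast (p+1).succ_ne_zero
  refine ⟨?_, ?_, ?_, ?_⟩
  · have := (bsh_formula n k m h).1
    simpa [bsh] using this
  · rcases m with _ | _ | m
    · simp [Nat.choose_eq_zero_of_lt (by omega : n + 1 < k)]
    · simp [Nat.choose_eq_zero_of_lt (by omega : n + 1 < k)]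
    · have e : n + 1 = k + m := by omega
      have e2 : (n + 1).factorial = (n + 1) * n.factorial := Nat.factorial_succ n
      have e3 : ((n + 1).choose k : ℂ) = (n + 1).factorial / (k.factorial * m.factorial) := by
        rw [e, Nat.cast_add_choose ℂ]
      rw [e3, e2, Nat.factorial_succ, Nat.factorial_succ]
      push_cast
      field_simp [hf, hs m, hs2 m]
      ring
  · rcases m with _ | m
    · simp [Nat.choose_eq_zero_of_lt (by omega : n + 2 < k)]
    · have e : n + 2 = k + m := by omega
      have e2 : (n + 2).factorial = (n + 2) * ((n + 1) * n.factorial) := by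
        rw [Nat.factorial_succ, Nat.factorial_succ]
      have e3 : ((n + 2).choose k : ℂ) = (n + 2).factorial / (k.factorial * m.factorial) := by
        rw [e, Nat.cast_add_choose ℂ]
      rw [e3, e2, Nat.factorial_succ]
      push_cast
      field_simp [hf, hs m]
  · have e2 : (n + 3).factorial = (n + 3) * ((n + 2) * ((n + 1) * n.factorial)) := by
      rw [Nat.factorial_succ, Nat.factorial_succ, Nat.factorial_succ]
    have e3 : ((n + 3).choose k : ℂ) = (n + 3).factorial / (k.factorial * m.factorial) := by
      rw [← h, Nat.cast_add_choose ℂ]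
    rw [e3, e2]
    push_cast
    ring

noncomputable def t1 (a₁ a₂ a₃ : ℂ) (n k : ℕ) : ℂ :=
  -(-1) ^ k * (bsh 1 n k : ℂ) *
    ((a₁ + a₂ + k) * poch (a₁ + a₂ + k + 1) (n + 1 - k)) *
    ((a₁ + a₃ + k) * poch (a₁ + a₃ + k + 1) (n + 1 - k)) * ((a₂ - a₁ - k) * (a₃ - a₁ - k))

noncomputable def t2 (a₁ a₂ a₃ : ℂ) (n k : ℕ) : ℂ :=
  (-1) ^ k * (bsh 2 n k : ℂ) * poch (a₁ + a₂ + k) (n + 2 - k) * poch (a₁ + a₃ + k) (n + 2 - k)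
    * (a₂ ^ 2 + a₃ ^ 2 - (a₁ + k - 1) ^ 2 - (a₁ + k) ^ 2)

noncomputable def t3 (a₁ a₂ a₃ : ℂ) (n k : ℕ) : ℂ :=
  -(-1) ^ k * (bsh 3 n k : ℂ) *
    poch (a₁ + a₂ + k - 1) (n + 3 - k) * poch (a₁ + a₃ + k - 1) (n + 3 - k)

lemma abstr (s W P Q X X1 Y Y1 B1 B2 B3 C0 C1 C2 C3 u1 u2 u3 u4 v3 v4 d c1 z0 z1 : ℂ)
    (key : -B1 * u1 + B2 * u2 - B3 * u3 * u4
      = -(C3 * v3 * v4 + d * C2 + c1 * z1 * C1 - z0 * z1 * C0)) :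
    -s * (B1 * W) * (P * X * X1) * (Q * Y * Y1) * u1
      + s * (B2 * W) * (P * X * X1) * (Q * Y * Y1) * u2
      + -s * (B3 * W) * (u3 * (P * X * X1)) * (u4 * (Q * Y * Y1))
    = -(s * (C3 * W) * (P * X * X1 * v3) * (Q * Y * Y1 * v4)
      + d * (s * (C2 * W) * (P * X * X1) * (Q * Y * Y1))
      + c1 * (X1 * Y1 * z1) * (s * (C1 * W) * (P * X) * (Q * Y))
      + (-(X * X1 * Y * Y1 * z0 * z1)) * (s * (C0 * W) * P * Q)) := by
  linear_combination (s * W * P * Q * X * X1 * Y * Y1) * key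

lemma coef (a₁ a₂ a₃ : ℂ) (n k m : ℕ) (h : k + m = n + 3) :
    t1 a₁ a₂ a₃ n k + t2 a₁ a₂ a₃ n k + t3 a₁ a₂ a₃ n k
    = -(cf (a₁ + a₂) (a₁ + a₃) (n + 3) k
        + (-((a₁*a₂ + a₁*a₃ + a₂*a₃) + (a₁ + a₂ + a₃ + n) * (a₁ + a₂ + a₃ + n + 1)
            + (2 * (n : ℂ) + 5) * (a₁ + a₂ + a₃ + n + 1) + n + 2)) *
            cf (a₁ + a₂) (a₁ + a₃) (n + 2) k
        + (2 * (a₁ + a₂ + a₃) + 3 * ((n : ℂ) + 1)) *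
            ((a₁ + a₂ + n + 1) * (a₁ + a₃ + n + 1) * (a₂ + a₃ + n + 1)) *
            cf (a₁ + a₂) (a₁ + a₃) (n + 1) k
        + (-((a₁ + a₂ + n) * (a₁ + a₂ + n + 1) * (a₁ + a₃ + n) * (a₁ + a₃ + n + 1) *
            (a₂ + a₃ + n) * (a₂ + a₃ + n + 1))) * cf (a₁ + a₂) (a₁ + a₃) n k) := by
  obtain ⟨-, hb1, hb2, hb3⟩ := bsh_formula n k m h
  obtain ⟨hc0, hc1, hc2, hc3⟩ := choose_formula n k m h
  simp only [t1, t2, t3, cf, hb1, hb2, hb3, hc0, hc1, hc2, hc3]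
  generalize (n.factorial / (k.factorial * m.factorial) : ℂ) = W
  generalize ((-1 : ℂ) ^ k) = s
  have hn : (n : ℂ) = k + m - 3 := by
    have : (k : ℂ) + m = n + 3 := by exact_mod_cast h
    linear_combination -this
  rcases m with _ | _ | _ | p
  · have e3 : n + 3 - k = 0 := by omega
    simp only [e3, poch_zero, hn]
    push_cast
    ring
  · have e3 : n + 3 - k = 1 := by omega
    have e2 : n + 2 - k = 0 := by omega
    simp only [e3, e2, poch_succ, poch_zero, hn]
    push_cast
    ring
  · have e3 : n + 3 - k = 2 := by omega
    have e2 : n + 2 - k = 1 := by omega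
    have e1 : n + 1 - k = 0 := by omega
    simp only [e3, e2, e1, poch_succ, poch_zero, hn]
    push_cast
    ring
  · have e3 : n + 3 - k = p + 2 + 1 := by omega
    have e2 : n + 2 - k = p + 2 := by omega
    have e1 : n + 1 - k = p + 1 := by omega
    have e0 : n - k = p := by omega
    have hn' : (n : ℂ) = k + p := by
      rw [hn]
      push_cast
      ring
    have r1 : ∀ x : ℂ, poch (x + k) (p + 1) = poch (x + k) p * (x + n) := by
      intro x
      rw [poch_succ, hn', add_assoc x]
    have r2 : ∀ x : ℂ, poch (x + k) (p + 2) = poch (x + k) p * (x + n) * (x + n + 1) := by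
      intro x
      rw [poch_succ, r1, hn']
      push_cast
      ring
    have r3 : ∀ x : ℂ, poch (x + k) (p + 2 + 1)
        = poch (x + k) p * (x + n) * (x + n + 1) * (x + n + 2) := by
      intro x
      rw [poch_succ, r2, hn']
      push_cast
      ring
    have hL : ∀ x : ℂ, (x + k) * poch (x + k + 1) (p + 1)
        = poch (x + k) p * (x + n) * (x + n + 1) := by
      intro x
      rw [← poch_succ_left, r2]
    have hM : ∀ x : ℂ, poch (x + k - 1) (p + 2 + 1)
        = (x + k - 1) * (poch (x + k) p * (x + n) * (x + n + 1)) := by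
      intro x
      rw [poch_succ_left, sub_add_cancel, r2]
    rw [e3, e2, e1, e0, hL, hL, hM, hM, r1, r1, r2, r2, r3, r3]
    refine abstr _ _ _ _ _ _ _ _ _ _ _ _ _ _ _ _ _ _ _ _ _ _ _ _ _ ?_
    rw [hn']
    push_cast
    ring

lemma lhs_eq (a₁ a₂ a₃ : ℂ) (n : ℕ) (η : ℂ) :
    (a₁ ^ 2 + η) * (a₂ ^ 2 + η) * (a₃ ^ 2 + η) * cdHPoly (a₁ + 1) (a₂ + 1) (a₃ + 1) n η
    = ∑ k ∈ range (n + 4), (t1 a₁ a₂ a₃ n k + t2 a₁ a₂ a₃ n k + t3 a₁ a₂ a₃ n k) *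
        phiB a₁ η k := by
  conv_rhs => simp only [add_mul, Finset.sum_add_distrib]
  have hz : ∀ i j, j < i → bsh i n j = 0 := by
    intro i j hj
    simp [bsh, hj]
  have hz' : ∀ i j, i + (n + 1) ≤ j → bsh i n j = 0 := by
    intro i j hj
    simp [bsh, Nat.choose_eq_zero_of_lt (by omega : n < j - i)]
  have h1 := sum_shift 1 (n + 1) 2 (fun k => t1 a₁ a₂ a₃ n k * phiB a₁ η k)
    (fun j hj => by simp [t1, hz 1 j hj]) (fun j hj => by simp [t1, hz' 1 j hj])
  have h2 := sum_shift 2 (n + 1) 1 (fun k => t2 a₁ a₂ a₃ n k * phiB a₁ η k)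
    (fun j hj => by simp [t2, hz 2 j hj]) (fun j hj => by simp [t2, hz' 2 j hj])
  have h3 := sum_shift 3 (n + 1) 0 (fun k => t3 a₁ a₂ a₃ n k * phiB a₁ η k)
    (fun j hj => by simp [t3, hz 3 j hj]) (fun j hj => by simp [t3, hz' 3 j hj])
  rw [show 1 + (n + 1) + 2 = n + 4 by omega] at h1
  rw [show 2 + (n + 1) + 1 = n + 4 by omega] at h2
  rw [show 3 + (n + 1) + 0 = n + 4 by omega] at h3
  rw [h1, h2, h3, cdH_eq _ _ _ n 0, ← Finset.sum_add_distrib, ← Finset.sum_add_distrib,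
    Finset.mul_sum]
  apply Finset.sum_congr rfl
  intro k _
  have hb : ∀ i, bsh i n (i + k) = n.choose k := by
    intro i
    simp [bsh]
  have p1 : phiB a₁ η (1 + k) = (a₁ ^ 2 + η) * phiB (a₁ + 1) η k := by
    rw [add_comm 1 k, phiB_succ_left]
  have p2 : phiB a₁ η (2 + k) = phiB a₁ η (1 + k) * ((a₁ + k + 1) ^ 2 + η) := by
    rw [show 2 + k = 1 + k + 1 by omega, phiB_succ]
    push_cast
    ring
  have p3 : phiB a₁ η (3 + k) = phiB a₁ η (2 + k) * ((a₁ + k + 2) ^ 2 + η) := by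
    rw [show 3 + k = 2 + k + 1 by omega, phiB_succ]
    push_cast
    ring
  simp only [t1, t2, t3, hb, cf, p3, p2, p1]
  rw [show n + 1 - (1 + k) = n - k by omega, show n + 2 - (2 + k) = n - k by omega,
    show n + 3 - (3 + k) = n - k by omega]
  push_cast
  have q : ∀ b : ℂ, a₁ + 1 + (b + 1) + k = a₁ + b + k + 2 := fun b => by ring
  have q1 : ∀ b : ℂ, a₁ + b + (1 + k) + 1 = a₁ + b + k + 2 := fun b => by ring
  have q2 : ∀ b : ℂ, a₁ + b + (2 + k) = a₁ + b + k + 2 := fun b => by ring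
  have q3 : ∀ b : ℂ, a₁ + b + (3 + k) - 1 = a₁ + b + k + 2 := fun b => by ring
  simp only [q, q1, q2, q3]
  generalize poch (a₁ + a₂ + k + 2) (n - k) = P
  generalize poch (a₁ + a₃ + k + 2) (n - k) = Q
  generalize phiB (a₁ + 1) η k = F
  ring

/-- The Christoffel relation (Theorem `thm:PhiPn` of the paper) for the continuous
dual Hahn polynomials. -/
theorem continuous_dual_hahn_christoffel
    (a₁ a₂ a₃ : ℂ) (n : ℕ) (η : ℂ) :
    (a₁ ^ 2 + η) * (a₂ ^ 2 + η) * (a₃ ^ 2 + η) * cdHPoly (a₁ + 1) (a₂ + 1) (a₃ + 1) n η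
    = -(cdHPoly a₁ a₂ a₃ (n + 3) η
        + (-((a₁*a₂ + a₁*a₃ + a₂*a₃) + (a₁ + a₂ + a₃ + n) * (a₁ + a₂ + a₃ + n + 1)
            + (2 * (n : ℂ) + 5) * (a₁ + a₂ + a₃ + n + 1) + n + 2)) *
            cdHPoly a₁ a₂ a₃ (n + 2) η
        + (2 * (a₁ + a₂ + a₃) + 3 * ((n : ℂ) + 1)) *
            ((a₁ + a₂ + n + 1) * (a₁ + a₃ + n + 1) * (a₂ + a₃ + n + 1)) *
            cdHPoly a₁ a₂ a₃ (n + 1) η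
        + (-((a₁ + a₂ + n) * (a₁ + a₂ + n + 1) * (a₁ + a₃ + n) * (a₁ + a₃ + n + 1) *
            (a₂ + a₃ + n) * (a₂ + a₃ + n + 1))) * cdHPoly a₁ a₂ a₃ n η) := by
  rw [lhs_eq, cdH_eq a₁ a₂ a₃ (n + 3) 0, cdH_eq a₁ a₂ a₃ (n + 2) 1, cdH_eq a₁ a₂ a₃ (n + 1) 2,
    cdH_eq a₁ a₂ a₃ n 3, show n + 3 + 1 + 0 = n + 4 by omega, show n + 2 + 1 + 1 = n + 4 by omega,
    show n + 1 + 1 + 2 = n + 4 by omega, show n + 1 + 3 = n + 4 by omega]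
  simp only [Finset.mul_sum, ← Finset.sum_add_distrib, ← Finset.sum_neg_distrib]
  apply Finset.sum_congr rfl
  intro k hk
  have hk' : k < n + 4 := by simpa using hk
  rw [coef a₁ a₂ a₃ n k (n + 3 - k) (by omega)]
  ring
end

section
/- Let q ∈ (0,1), let a,b be nonzero complex numbers, and let n ∈ ℤ≥0. Then for all x ∈ ℂ: (1−a e^{ix})(1−a e^{−ix})(1−b e^{ix})(1−b e^{−ix}) · Q_n(cos x; qa, qb | q) = ab · Q_{n+2}(cos x; a,b|q) − (a+b)(1 − ab q^{n+1}) · Q_{n+1}(cos x; a,b|q) + (1 − ab q^{n})(1 − ab q^{n+1}) · Q_n(cos x; a,b|q). -/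
open Complex Finset

/-- q-Pochhammer symbol `(a;q)_k = ∏_{j=0}^{k-1} (1 - a q^j)`. -/
noncomputable def qPoch (q a : ℂ) (k : ℕ) : ℂ := ∏ j ∈ Finset.range k, (1 - a * q ^ j)

/-- Al-Salam–Chihara polynomial `Q_n(cos x; a,b | q)` as a function of `x ∈ ℂ`. -/
noncomputable def ascPoly (q a b : ℂ) (n : ℕ) (x : ℂ) : ℂ :=
  a ^ (-(n : ℤ)) * ∑ k ∈ Finset.range (n + 1),
    qPoch q (q ^ (-(n : ℤ))) k * qPoch q (a * Complex.exp (Complex.I * x)) k *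
      qPoch q (a * Complex.exp (-(Complex.I * x))) k * q ^ k / qPoch q q k *
      qPoch q (a * b * q ^ k) (n - k)

lemma qPoch_succ (q a : ℂ) (k : ℕ) : qPoch q a (k+1) = qPoch q a k * (1 - a * q^k) := by
  simp [qPoch, Finset.prod_range_succ]

lemma qPoch_succ' (q a : ℂ) (k : ℕ) : qPoch q a (k+1) = (1 - a) * qPoch q (a * q) k := by
  simp only [qPoch, Finset.prod_range_succ', pow_zero, mul_one]
  rw [mul_comm]
  congr 1
  refine Finset.prod_congr rfl fun j _ => ?_
  ring

/-- The coefficients `(q^{-n};q)_k q^k/(q;q)_k`. -/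
noncomputable def ascE (q : ℂ) (n k : ℕ) : ℂ := qPoch q ((q^n)⁻¹) k * q^k / qPoch q q k

lemma ascE_zero (q : ℂ) (n : ℕ) : ascE q n 0 = 1 := by simp [ascE, qPoch]

lemma qPoch_qq_ne {q : ℂ} (h : ∀ k : ℕ, 1 - q * q^k ≠ 0) (k : ℕ) : qPoch q q k ≠ 0 :=
  Finset.prod_ne_zero_iff.2 fun j _ => h j

lemma ascE_top (q : ℂ) (hq : q ≠ 0) (n k : ℕ) (hk : n < k) : ascE q n k = 0 := by
  have : qPoch q ((q^n)⁻¹) k = 0 := by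
    refine Finset.prod_eq_zero (Finset.mem_range.2 hk) ?_
    rw [inv_mul_cancel₀ (pow_ne_zero _ hq), sub_self]
  simp [ascE, this]

lemma ascE_pascal {q : ℂ} (hq : q ≠ 0) (h : ∀ k : ℕ, 1 - q * q^k ≠ 0) (n k : ℕ) :
    ascE q n (k+1) - ascE q (n+1) (k+1) = (q^n)⁻¹ * ascE q n k := by
  have h1 := h k
  have h2 := qPoch_qq_ne h k
  have h3 : (q^(n+1))⁻¹ * q = (q^n)⁻¹ := by rw [pow_succ]; field_simp
  have h4 : (q^(n+1))⁻¹ = (q^n)⁻¹ * q⁻¹ := by rw [pow_succ, mul_inv]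
  unfold ascE
  rw [qPoch_succ' q ((q^(n+1))⁻¹), h3, qPoch_succ, qPoch_succ, h4]
  generalize (q^n)⁻¹ = u
  have hqk : q^k ≠ 0 := pow_ne_zero _ hq
  rw [pow_succ]
  generalize q^k = Q at *
  generalize hd : 1 - q * Q = d at *
  field_simp
  linear_combination qPoch q u k * u * hd

lemma ascE_pascal' {q : ℂ} (hq : q ≠ 0) (h : ∀ k : ℕ, 1 - q * q^k ≠ 0) (n k : ℕ) :
    ascE q (n+1) (k+1) = (q^(k+1))⁻¹ * ascE q n (k+1) - (q^k)⁻¹ * ascE q n k := by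
  have h1 := h k
  have h2 := qPoch_qq_ne h k
  have h3 : (q^(n+1))⁻¹ * q = (q^n)⁻¹ := by rw [pow_succ]; field_simp
  have h4 : (q^(n+1))⁻¹ = (q^n)⁻¹ * q⁻¹ := by rw [pow_succ, mul_inv]
  unfold ascE
  rw [qPoch_succ' q ((q^(n+1))⁻¹), h3, qPoch_succ, qPoch_succ, h4]
  generalize (q^n)⁻¹ = u
  have hqk : q^k ≠ 0 := pow_ne_zero _ hq
  rw [pow_succ]
  generalize q^k = Q at *
  field_simp
  ring

lemma sumA {q : ℂ} (hq : q ≠ 0) (h : ∀ k : ℕ, 1 - q * q^k ≠ 0) (n M : ℕ) (F : ℕ → ℂ) :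
    ∑ k ∈ range (M+1), F k * ascE q n k - ∑ k ∈ range (M+1), F k * ascE q (n+1) k
      = (q^n)⁻¹ * ∑ k ∈ range M, F (k+1) * ascE q n k := by
  rw [← Finset.sum_sub_distrib, Finset.sum_range_succ', Finset.mul_sum]
  simp only [ascE_zero, sub_self, add_zero]
  refine Finset.sum_congr rfl fun k _ => ?_
  linear_combination F (k+1) * ascE_pascal hq h n k

lemma sumB {q : ℂ} (hq : q ≠ 0) (h : ∀ k : ℕ, 1 - q * q^k ≠ 0) (n M : ℕ) (F : ℕ → ℂ) :
    ∑ k ∈ range (M+1), F k * ascE q (n+1) k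
      = ∑ k ∈ range (M+1), F k * ((q^k)⁻¹ * ascE q n k)
        - ∑ k ∈ range M, F (k+1) * ((q^k)⁻¹ * ascE q n k) := by
  rw [Finset.sum_range_succ', Finset.sum_range_succ' (n := M)]
  simp only [ascE_zero, pow_zero, inv_one, mul_one]
  rw [add_sub_right_comm, ← Finset.sum_sub_distrib]
  congr 1
  refine Finset.sum_congr rfl fun k _ => ?_
  linear_combination F (k+1) * ascE_pascal' hq h n k

/-- Extension of the range of summation, pulling out the factors of `(ab q^k;q)_{N-k}`. -/
lemma asc_extend (q : ℂ) (hq : q ≠ 0) (a b x : ℂ) (m d : ℕ) :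
    (∏ i ∈ range d, (1 - a * b * q^(m+i))) * ascPoly q a b m x =
      (a^m)⁻¹ * ∑ k ∈ range (m+d+1), (qPoch q (a * Complex.exp (Complex.I * x)) k *
        qPoch q (a * Complex.exp (-(Complex.I * x))) k * qPoch q (a*b*q^k) (m+d-k))
         * ascE q m k := by
  have hs : ∑ k ∈ range (m+1), (qPoch q (a * Complex.exp (Complex.I * x)) k *
        qPoch q (a * Complex.exp (-(Complex.I * x))) k * qPoch q (a*b*q^k) (m+d-k))
         * ascE q m k = ∑ k ∈ range (m+d+1), (qPoch q (a * Complex.exp (Complex.I * x)) k *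
        qPoch q (a * Complex.exp (-(Complex.I * x))) k * qPoch q (a*b*q^k) (m+d-k))
         * ascE q m k := by
    refine Finset.sum_subset (Finset.range_mono (by omega)) fun k _ hk => ?_
    rw [ascE_top q hq m k (by simpa using hk), mul_zero]
  rw [← hs, ascPoly, zpow_neg, zpow_natCast, mul_left_comm, Finset.mul_sum]
  congr 1
  refine Finset.sum_congr rfl fun k hk => ?_
  have hk' : k ≤ m := by simpa [Nat.lt_succ_iff] using hk
  have hP : qPoch q (a*b*q^k) (m+d-k) =
      qPoch q (a*b*q^k) (m-k) * ∏ i ∈ range d, (1 - a * b * q^(m+i)) := by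
    have : m + d - k = (m-k) + d := by omega
    rw [this, qPoch, qPoch, Finset.prod_range_add]
    congr 1
    refine Finset.prod_congr rfl fun i _ => ?_
    have : m + i = k + (m - k + i) := by omega
    rw [this, pow_add q k]; ring
  rw [hP, ascE, zpow_neg, zpow_natCast]
  ring

theorem asc_aux (q : ℂ) (hq : q ≠ 0) (h : ∀ k : ℕ, 1 - q * q^k ≠ 0)
    (a b : ℂ) (ha : a ≠ 0) (n : ℕ) (x : ℂ) :
    (1 - a * Complex.exp (Complex.I * x)) * (1 - a * Complex.exp (-(Complex.I * x))) *
      (1 - b * Complex.exp (Complex.I * x)) * (1 - b * Complex.exp (-(Complex.I * x))) *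
      ascPoly q (q * a) (q * b) n x
    = a * b * ascPoly q a b (n + 2) x
      - (a + b) * (1 - a * b * q ^ (n + 1)) * ascPoly q a b (n + 1) x
      + (1 - a * b * q ^ n) * (1 - a * b * q ^ (n + 1)) *
          ascPoly q a b n x := by
  have e0 := asc_extend q hq a b x n 2
  have e1 := asc_extend q hq a b x (n+1) 1
  have e2 := asc_extend q hq a b x (n+2) 0
  have e3 := asc_extend q hq (q*a) (q*b) x n 0
  simp only [Finset.prod_range_succ, Finset.prod_range_zero, one_mul, add_zero] at e0 e1 e2 e3
  have hzw : Complex.exp (Complex.I * x) * Complex.exp (-(Complex.I * x)) = 1 := by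
    rw [← Complex.exp_add]; simp
  generalize Complex.exp (Complex.I * x) = z at *
  generalize Complex.exp (-(Complex.I * x)) = w at *
  rw [show n + 1 + 1 = n + 2 from rfl] at e1
  obtain ⟨F, hF⟩ : ∃ F : ℕ → ℂ, F = fun k => qPoch q (a * z) k * qPoch q (a * w) k *
    qPoch q (a*b*q^k) (n+2-k) := ⟨_, rfl⟩
  have hF' : ∀ k, qPoch q (a * z) k * qPoch q (a * w) k *
    qPoch q (a*b*q^k) (n+2-k) = F k := fun k => by rw [hF]
  simp only [hF'] at e0 e1 e2
  have hA := sumA hq h n (n+2) F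
  have hA' := sumA hq h (n+1) (n+2) F
  have hB := sumB hq h n (n+1) (fun k => F (k+1))
  have t1 : ∑ k ∈ range (n+2), F (k+1) * ascE q n k = ∑ k ∈ range (n+1), F (k+1) * ascE q n k := by
    rw [Finset.sum_range_succ, ascE_top q hq n (n+1) (by omega)]; simp
  have t2 : ∑ k ∈ range (n+2), F (k+1) * ((q^k)⁻¹ * ascE q n k)
      = ∑ k ∈ range (n+1), F (k+1) * ((q^k)⁻¹ * ascE q n k) := by
    rw [Finset.sum_range_succ, ascE_top q hq n (n+1) (by omega)]; simp
  have key : (1 - a * z) * (1 - a * w) * (1 - b * z) * (1 - b * w) *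
      ∑ k ∈ range (n+1), qPoch q (q * a * z) k * qPoch q (q * a * w) k *
        qPoch q (q * a * (q * b) * q ^ k) (n - k) * ascE q n k =
      ∑ k ∈ range (n+1), F (k+1) * ascE q n k
      - b / (a * q) * (∑ k ∈ range (n+1), F (k+1) * ((q^k)⁻¹ * ascE q n k)
        - ∑ k ∈ range (n+1), F (k+1+1) * ((q^k)⁻¹ * ascE q n k)) := by
    rw [← Finset.sum_sub_distrib, Finset.mul_sum, Finset.mul_sum, ← Finset.sum_sub_distrib]
    refine Finset.sum_congr rfl fun k hk => ?_
    have hk' : k ≤ n := by simpa [Nat.lt_succ_iff] using hk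
    have p1 : F (k+1) = (1 - a*z) * qPoch q (q*a*z) k * ((1 - a*w) * qPoch q (q*a*w) k) *
        ((1 - a*b*q^(k+1)) * qPoch q (q * a * (q * b) * q ^ k) (n - k)) := by
      rw [hF]
      have : n + 2 - (k+1) = (n-k)+1 := by omega
      simp only [this]
      rw [qPoch_succ', qPoch_succ', qPoch_succ']
      ring_nf
    have p2 : F (k+1+1) = (1 - a*z) * (qPoch q (q*a*z) k * (1 - q*a*z*q^k)) *
        ((1 - a*w) * (qPoch q (q*a*w) k * (1 - q*a*w*q^k))) *
        qPoch q (q * a * (q * b) * q ^ k) (n - k) := by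
      rw [hF]
      have : n + 2 - (k+1+1) = (n-k) := by omega
      simp only [this]
      rw [qPoch_succ', qPoch_succ' q (a*w), qPoch_succ, qPoch_succ]
      ring_nf
    rw [p1, p2]
    generalize qPoch q (q*a*z) k = X
    generalize qPoch q (q*a*w) k = Y
    generalize qPoch q (q * a * (q * b) * q ^ k) (n - k) = Z
    generalize ascE q n k = E
    have hqk : q^k ≠ 0 := pow_ne_zero _ hq
    rw [pow_succ]
    generalize q^k = Q at *
    have id : (1 - b*z)*(1-b*w) = (1 - a*b*(Q*q)) - b/(a*q) * (Q⁻¹ * (1 - a*b*(Q*q))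
        - Q⁻¹ * ((1 - q*a*z*Q) * (1 - q*a*w*Q))) := by
      field_simp
      linear_combination a * q * Q * (b - a * q * Q) * b * hzw
    linear_combination (1 - a*z) * (1-a*w) * X * Y * Z * E * id
  have hqn : q^n ≠ 0 := pow_ne_zero _ hq
  have han : a^n ≠ 0 := pow_ne_zero _ ha
  rw [e3, mul_left_comm, key]
  rw [mul_assoc (a+b), e1, e2, e0]
  rw [t1] at hA
  rw [show n + 1 + 1 = n + 2 from rfl] at hA' hB
  rw [hB, t2] at hA'
  generalize (∑ k ∈ range (n+1), F (k+1) * ascE q n k) = S1 at *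
  generalize (∑ k ∈ range (n+1), F (k+1) * ((q^k)⁻¹ * ascE q n k)) = S2 at *
  generalize (∑ k ∈ range (n+1), F (k+1+1) * ((q^k)⁻¹ * ascE q n k)) = S3 at *
  generalize (∑ k ∈ range (n+2+1), F k * ascE q n k) = T0 at *
  generalize (∑ k ∈ range (n+2+1), F k * ascE q (n+1) k) = T1 at *
  generalize (∑ k ∈ range (n+2+1), F k * ascE q (n+1+1) k) = T2 at *
  have r0 : T0 = T1 + (q^n)⁻¹ * S1 := by linear_combination hA
  have r2 : T2 = T1 - (q^(n+1))⁻¹ * (S2 - S3) := by linear_combination -hA'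
  rw [r0, r2, mul_pow]
  field_simp
  ring



/-- The Christoffel relation (Theorem `thm:PhiPn` of the paper) for the
Al-Salam–Chihara polynomials. -/
theorem al_salam_chihara_christoffel
    (q : ℝ) (hq0 : 0 < q) (hq1 : q < 1)
    (a b : ℂ) (ha : a ≠ 0) (hb : b ≠ 0) (n : ℕ) (x : ℂ) :
    (1 - a * Complex.exp (Complex.I * x)) * (1 - a * Complex.exp (-(Complex.I * x))) *
      (1 - b * Complex.exp (Complex.I * x)) * (1 - b * Complex.exp (-(Complex.I * x))) *
      ascPoly (q : ℂ) ((q : ℂ) * a) ((q : ℂ) * b) n x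
    = a * b * ascPoly (q : ℂ) a b (n + 2) x
      - (a + b) * (1 - a * b * (q : ℂ) ^ (n + 1)) * ascPoly (q : ℂ) a b (n + 1) x
      + (1 - a * b * (q : ℂ) ^ n) * (1 - a * b * (q : ℂ) ^ (n + 1)) *
          ascPoly (q : ℂ) a b n x := by
  have hq : (q : ℂ) ≠ 0 := by exact_mod_cast hq0.ne'
  refine asc_aux q hq (fun k => ?_) a b ha n x
  have : q * q^k < 1 := by
    rw [← pow_succ']
    exact pow_lt_one₀ hq0.le hq1 (by omega)
  have h' : 1 - q * q^k ≠ 0 := by linarith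
  exact_mod_cast h'
end

section
/- Let h, μ ∈ ℝ with 2h not an integer, and let n ∈ ℤ≥0. Then for all η ∈ ℂ: (1+η²) · (d/dη) P_{n+1}(η; h, μ) = (n+1) · [ P_{n+2}(η; h, μ) − (4μ(2h−n−1)/((2h−2n−1)(2h−2n−3))) · P_{n+1}(η; h, μ) + ((2h−n−1)(2h−n)((2h−2n−1)²+4μ²)/(4(h−n−1)(h−n)(2h−2n−1)²)) · P_n(η; h, μ) ]. -/
open Complex Finset

/-- Pseudo Jacobi polynomial `P_n(η; h, μ)` as a function of `η ∈ ℂ`. -/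
noncomputable def pseudoJacobiPoly (h μ : ℝ) (n : ℕ) (η : ℂ) : ℂ :=
  (-2 * Complex.I) ^ n * ∑ k ∈ Finset.range (n + 1),
    poch (-(n : ℂ)) k * ((1 - Complex.I * η) / 2) ^ k *
      poch (-(h : ℂ) + 1 / 2 - Complex.I * (μ : ℂ) + k) (n - k) /
      ((k.factorial : ℂ) * poch ((n : ℂ) - 2 * (h : ℂ) + k) (n - k))

/-- Coefficients with `a = -h+1/2-iμ`, `b = -2h`. -/
noncomputable def pjc (a b : ℂ) (n k : ℕ) : ℂ :=
  poch (-(n : ℂ)) k * poch (a + k) (n - k) /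
    ((k.factorial : ℂ) * poch ((n : ℂ) + b + k) (n - k))

lemma poch_ne (x : ℂ) (hx : ∀ m : ℕ, x + m ≠ 0) (m : ℕ) : poch x m ≠ 0 :=
  Finset.prod_ne_zero_iff.mpr fun j _ => hx j

lemma poch_neg_zero (n k : ℕ) (hk : n < k) : poch (-(n : ℂ)) k = 0 :=
  Finset.prod_eq_zero (Finset.mem_range.mpr hk) (by ring)

lemma pjc_zero (a b : ℂ) (n k : ℕ) (hk : n < k) : pjc a b n k = 0 := by
  simp [pjc, poch_neg_zero n k hk]

lemma pjc_k (a b : ℂ) (hb : ∀ m : ℕ, b + m ≠ 0) (n k : ℕ) :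
    ((k : ℂ) + 1) * (a + k) * pjc a b n (k + 1) = (k - n) * (n + k + b) * pjc a b n k := by
  rcases lt_or_ge k n with hk | hk
  · obtain ⟨d, rfl⟩ := Nat.exists_eq_add_of_lt hk
    have e1 : k + d + 1 - (k + 1) = d := by omega
    have e2 : k + d + 1 - k = d + 1 := by omega
    have h1 : ((k + d + 1 : ℕ) : ℂ) + b + k ≠ 0 := by
      have := hb (k + d + 1 + k); push_cast at this ⊢
      intro h; apply this; linear_combination h
    have h2 : poch (((k + d + 1 : ℕ) : ℂ) + b + k + 1) d ≠ 0 := by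
      apply poch_ne; intro m
      have := hb (k + d + 1 + k + 1 + m); push_cast at this ⊢
      intro h; apply this; linear_combination h
    have h3 : (k.factorial : ℂ) ≠ 0 := by exact_mod_cast k.factorial_ne_zero
    have h4 : (k : ℂ) + 1 ≠ 0 := by exact_mod_cast k.succ_ne_zero
    unfold pjc
    rw [e1, e2, poch_succ, poch_succ_left (a + k), poch_succ_left (_ + b + _),
      Nat.factorial_succ]
    have e3 : a + ((k + 1 : ℕ) : ℂ) = a + k + 1 := by push_cast; ring
    have e4 : ((k + d + 1 : ℕ) : ℂ) + b + ((k + 1 : ℕ) : ℂ)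
      = ((k + d + 1 : ℕ) : ℂ) + b + k + 1 := by push_cast; ring
    rw [e3, e4]
    generalize poch (((k + d + 1 : ℕ) : ℂ) + b + k + 1) d = Q at *
    generalize poch (a + k + 1) d = R at *
    generalize poch (-((k + d + 1 : ℕ) : ℂ)) k = S at *
    generalize ((k + d + 1 : ℕ) : ℂ) = N at *
    push_cast
    field_simp
    ring
  · rw [pjc_zero a b n (k + 1) (by omega)]
    rcases hk.eq_or_lt with rfl | hk
    · simp
    · rw [pjc_zero a b n k hk]; simp

lemma poch_neg_shift (n k : ℕ) :
    ((n : ℂ) + 1 - k) * poch (-((n + 1 : ℕ) : ℂ)) k = (n + 1) * poch (-(n : ℂ)) k := by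
  have h1 := poch_succ (-((n + 1 : ℕ) : ℂ)) k
  rw [poch_succ_left] at h1
  have e : -((n + 1 : ℕ) : ℂ) + 1 = -(n : ℂ) := by push_cast; ring
  rw [e] at h1
  push_cast at h1 ⊢
  linear_combination h1

lemma pjc_n (a b : ℂ) (hb : ∀ m : ℕ, b + m ≠ 0) (n k : ℕ) :
    ((n : ℂ) + 1 - k) * (2 * n + b) * (2 * n + 1 + b) * pjc a b (n + 1) k
      = (n + 1) * (a + n) * (n + k + b) * pjc a b n k := by
  rcases Nat.lt_or_ge n k with hk | hk
  · rw [pjc_zero a b n k hk]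
    rcases Nat.lt_or_ge (n + 1) k with hk' | hk'
    · rw [pjc_zero a b _ k hk']; simp
    · have : k = n + 1 := by omega
      subst this; simp
  · obtain ⟨d, rfl⟩ := Nat.exists_eq_add_of_le hk
    have e1 : k + d + 1 - k = d + 1 := by omega
    have e2 : k + d - k = d := by omega
    have hs := poch_neg_shift (k + d) k
    have h3 : (k.factorial : ℂ) ≠ 0 := by exact_mod_cast k.factorial_ne_zero
    have h1 : ∀ m : ℕ, ((k + d : ℕ) : ℂ) + b + k + m ≠ 0 := by
      intro m
      have := hb (k + d + k + m); push_cast at this ⊢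
      intro h; apply this; linear_combination h
    have p1 := poch_ne _ h1 d
    have p2 : poch (((k + d : ℕ) : ℂ) + b + k + 1) (d + 1) ≠ 0 := by
      apply poch_ne; intro m
      have := h1 (1 + m); push_cast at this ⊢
      intro h; apply this; linear_combination h
    have hq : poch (((k + d : ℕ) : ℂ) + b + k) d * (2 * (k + d : ℕ) + b) *
        (2 * (k + d : ℕ) + 1 + b) = (((k + d : ℕ) : ℂ) + k + b) *
          poch (((k + d : ℕ) : ℂ) + b + k + 1) (d + 1) := by
      have q1 := poch_succ (((k + d : ℕ) : ℂ) + b + k) (d + 1)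
      rw [poch_succ_left, poch_succ (((k + d : ℕ) : ℂ) + b + k) d] at q1
      push_cast at q1 ⊢
      linear_combination -q1
    unfold pjc
    rw [e1, e2, poch_succ (a + k)]
    have e4 : ((k + d + 1 : ℕ) : ℂ) + b + k = ((k + d : ℕ) : ℂ) + b + k + 1 := by
      push_cast; ring
    have e5 : a + ((k + d : ℕ) : ℂ) = a + k + d := by push_cast; ring
    rw [e4, e5]
    generalize poch (((k + d : ℕ) : ℂ) + b + k + 1) (d + 1) = Q at *
    generalize poch (((k + d : ℕ) : ℂ) + b + k) d = Q' at *
    generalize poch (a + k) d = R at *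
    generalize poch (-((k + d + 1 : ℕ) : ℂ)) k = S at *
    generalize poch (-((k + d : ℕ) : ℂ)) k = S' at *
    generalize ((k + d : ℕ) : ℂ) = N at *
    rw [mul_div_assoc', mul_div_assoc', div_eq_div_iff (mul_ne_zero h3 p2) (mul_ne_zero h3 p1)]
    linear_combination (k.factorial : ℂ) * R * (a + k + d) *
      ((N + 1 - k) * S * hq + (N + k + b) * Q * hs)

lemma coef_zero (a b : ℂ) (hb : ∀ m : ℤ, b + m ≠ 0) (ha : ∀ m : ℕ, a + m ≠ 0) (n : ℕ) :
    -4 * pjc a b (n + 2) 0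
      - 4 * (b + 1 - 2 * a) * (b + n + 1) / ((b + 2 * n + 1) * (b + 2 * n + 3)) *
        pjc a b (n + 1) 0
      + 4 * (b + n + 1) * (b + n) * (n + a) * (n + 1 + b - a) /
        ((b + 2 * n + 2) * (b + 2 * n) * (b + 2 * n + 1) ^ 2) * pjc a b n 0 = 0 := by
  have hn : ∀ m : ℕ, b + m ≠ 0 := fun m => by exact_mod_cast hb m
  have f0 : b + 2 * (n : ℂ) ≠ 0 := by have := hn (2 * n); push_cast at this; exact this
  have f1 : b + 2 * (n : ℂ) + 1 ≠ 0 := by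
    have := hn (2 * n + 1); push_cast at this; rwa [add_assoc]
  have f2 : b + 2 * (n : ℂ) + 2 ≠ 0 := by
    have := hn (2 * n + 2); push_cast at this; rwa [add_assoc]
  have f3 : b + 2 * (n : ℂ) + 3 ≠ 0 := by
    have := hn (2 * n + 3); push_cast at this; rwa [add_assoc]
  have g1 : (n : ℂ) + 1 ≠ 0 := by exact_mod_cast n.succ_ne_zero
  have g2 : (n : ℂ) + 2 ≠ 0 := by exact_mod_cast (n + 1).succ_ne_zero
  have ga := ha n
  have k0 : b + (n : ℂ) ≠ 0 := hn n
  have r1 := pjc_n a b hn n 0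
  have r2 := pjc_n a b hn (n + 1) 0
  push_cast at r1 r2
  have s1 : pjc a b (n + 1) 0 =
      (a + n) * (b + n) * pjc a b n 0 / ((b + 2 * n) * (b + 2 * n + 1)) := by
    rw [eq_div_iff (mul_ne_zero f0 f1)]
    apply mul_left_cancel₀ g1
    linear_combination r1
  have s2 : pjc a b (n + 2) 0 =
      (a + n + 1) * (b + n + 1) * pjc a b (n + 1) 0 / ((b + 2 * n + 2) * (b + 2 * n + 3)) := by
    rw [eq_div_iff (mul_ne_zero f2 f3)]
    apply mul_left_cancel₀ g2
    linear_combination r2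
  rw [s2, s1]
  generalize pjc a b n 0 = D
  clear r1 r2 s1 s2 hn ha hb
  generalize (n : ℂ) = N at *
  rw [add_eq_zero_iff_eq_neg]
  generalize ht : b + 2 * N = t at *
  obtain rfl : b = t - 2 * N := by rw [← ht]; ring
  have ga' : N + a ≠ 0 := by rwa [add_comm]
  field_simp
  ring

lemma coef_succ (a b : ℂ) (hb : ∀ m : ℤ, b + m ≠ 0) (ha : ∀ m : ℕ, a + m ≠ 0) (n j : ℕ)
    (hj : j < n + 2) :
    -4 * ((j + 1) * pjc a b (n + 1) (j + 1) - j * pjc a b (n + 1) j) =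
    (n + 1) * (-4 * pjc a b (n + 2) (j + 1)
      - 4 * (b + 1 - 2 * a) * (b + n + 1) / ((b + 2 * n + 1) * (b + 2 * n + 3)) *
        pjc a b (n + 1) (j + 1)
      + 4 * (b + n + 1) * (b + n) * (n + a) * (n + 1 + b - a) /
        ((b + 2 * n + 2) * (b + 2 * n) * (b + 2 * n + 1) ^ 2) * pjc a b n (j + 1)) := by
  have hn : ∀ m : ℕ, b + m ≠ 0 := fun m => by exact_mod_cast hb m
  have f0 : b + 2 * (n : ℂ) ≠ 0 := by have := hn (2 * n); push_cast at this; exact this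
  have f1 : b + 2 * (n : ℂ) + 1 ≠ 0 := by
    have := hn (2 * n + 1); push_cast at this; rwa [add_assoc]
  have f2 : b + 2 * (n : ℂ) + 2 ≠ 0 := by
    have := hn (2 * n + 2); push_cast at this; rwa [add_assoc]
  have f3 : b + 2 * (n : ℂ) + 3 ≠ 0 := by
    have := hn (2 * n + 3); push_cast at this; rwa [add_assoc]
  have g1 : (n : ℂ) + 1 ≠ 0 := by exact_mod_cast n.succ_ne_zero
  have g2 : (n : ℂ) + 2 ≠ 0 := by exact_mod_cast (n + 1).succ_ne_zero
  have ga := ha n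
  have gj : (j : ℂ) + 1 ≠ 0 := by exact_mod_cast j.succ_ne_zero
  have gaj := ha j
  have gnj : (n : ℂ) + 2 - j ≠ 0 := by
    intro h
    have h' : ((n + 2 : ℕ) : ℂ) = (j : ℂ) := by push_cast; linear_combination h
    have := Nat.cast_injective h'
    omega
  have kj : b + n + j + 1 ≠ 0 := by
    have := hn (n + j + 1); push_cast at this; intro h; apply this; linear_combination h
  have r1 := pjc_k a b hn (n + 1) j
  have r2 := pjc_k a b hn (n + 2) j
  have r3 := pjc_n a b hn (n + 1) j
  have r4 := pjc_n a b hn n (j + 1)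
  push_cast at r1 r2 r3 r4
  have s1 : pjc a b (n + 1) (j + 1) =
      (j - n - 1) * (b + n + j + 1) * pjc a b (n + 1) j / ((j + 1) * (a + j)) := by
    rw [eq_div_iff (mul_ne_zero gj gaj)]
    linear_combination r1
  have s3 : pjc a b (n + 2) j = (n + 2) * (a + n + 1) * (b + n + j + 1) * pjc a b (n + 1) j /
      ((n + 2 - j) * (b + 2 * n + 2) * (b + 2 * n + 3)) := by
    rw [eq_div_iff (mul_ne_zero (mul_ne_zero gnj f2) f3)]
    linear_combination r3
  have s2 : pjc a b (n + 2) (j + 1) =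
      - (n + 2) * (a + n + 1) * (b + n + j + 1) * (b + n + j + 2) * pjc a b (n + 1) j /
      ((b + 2 * n + 2) * (b + 2 * n + 3) * ((j + 1) * (a + j))) := by
    have : pjc a b (n + 2) (j + 1) =
      -(n + 2 - j) * (b + n + j + 2) * pjc a b (n + 2) j / ((j + 1) * (a + j)) := by
      rw [eq_div_iff (mul_ne_zero gj gaj)]
      linear_combination r2
    rw [this, s3]
    field_simp
  have s4 : pjc a b n (j + 1) = (n - j) * (b + 2 * n) * (b + 2 * n + 1) *
      ((j - n - 1) * pjc a b (n + 1) j / ((j + 1) * (a + j))) / ((n + 1) * (a + n)) := by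
    rw [eq_div_iff (mul_ne_zero g1 ga)]
    apply mul_left_cancel₀ kj
    rw [s1] at r4
    linear_combination -r4
  rw [s1, s2, s4]
  generalize pjc a b (n + 1) j = D
  clear r1 r2 r3 r4 s1 s2 s3 s4 hn ha hb
  generalize ht : b + 2 * (n : ℂ) = t at *
  obtain rfl : b = t - 2 * n := by rw [← ht]; ring
  have ga' : (n : ℂ) + a ≠ 0 := by rwa [add_comm]
  field_simp
  ring

lemma pj_eq (h μ : ℝ) (n N : ℕ) (hN : n + 1 ≤ N) (η : ℂ) :
    pseudoJacobiPoly h μ n η = (-2 * Complex.I) ^ n * ∑ k ∈ Finset.range N,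
      pjc (-(h : ℂ) + 1 / 2 - Complex.I * μ) (-2 * h) n k * ((1 - Complex.I * η) / 2) ^ k := by
  unfold pseudoJacobiPoly
  congr 1
  rw [← Finset.sum_subset (Finset.range_subset_range.mpr hN)]
  · refine Finset.sum_congr rfl fun k _ => ?_
    unfold pjc
    rw [show (n : ℂ) + -2 * h + k = n - 2 * h + k by ring]
    ring
  · intro k _ hk
    rw [pjc_zero _ _ _ _ (by simpa using hk), zero_mul]

/-- The differential relation (Theorem `thm:bibunrel` of the paper) for the pseudo
Jacobi polynomials. -/
theorem pseudo_jacobi_differential_relation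
    (h μ : ℝ) (hh : ∀ m : ℤ, 2 * h ≠ (m : ℝ)) (n : ℕ) (η : ℂ) :
    (1 + η ^ 2) * deriv (fun y => pseudoJacobiPoly h μ (n + 1) y) η
    = ((n : ℂ) + 1) *
        (pseudoJacobiPoly h μ (n + 2) η
          - 4 * (μ : ℂ) * (2 * (h : ℂ) - n - 1) /
              ((2 * (h : ℂ) - 2 * n - 1) * (2 * (h : ℂ) - 2 * n - 3)) *
              pseudoJacobiPoly h μ (n + 1) η
          + (2 * (h : ℂ) - n - 1) * (2 * (h : ℂ) - n) *
              ((2 * (h : ℂ) - 2 * n - 1) ^ 2 + 4 * (μ : ℂ) ^ 2) /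
              (4 * ((h : ℂ) - n - 1) * ((h : ℂ) - n) * (2 * (h : ℂ) - 2 * n - 1) ^ 2) *
              pseudoJacobiPoly h μ n η) := by
  have hb : ∀ m : ℤ, (-2 * h : ℂ) + m ≠ 0 := by
    intro m hm
    apply hh m
    have : ((2 * h : ℝ) : ℂ) = ((m : ℝ) : ℂ) := by push_cast; linear_combination -hm
    exact_mod_cast this
  have ha : ∀ m : ℕ, (-(h : ℂ) + 1 / 2 - Complex.I * μ) + m ≠ 0 := by
    intro m hm
    apply hh (2 * m + 1)
    have := congrArg Complex.re hm
    simp at this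
    push_cast
    linarith
  have hP1 : (fun y => pseudoJacobiPoly h μ (n + 1) y) = fun y => (-2 * Complex.I) ^ (n + 1) *
      ∑ k ∈ Finset.range (n + 3), pjc (-(h : ℂ) + 1 / 2 - Complex.I * μ) (-2 * h) (n + 1) k *
        ((1 - Complex.I * y) / 2) ^ k := by
    funext y; exact pj_eq h μ (n + 1) (n + 3) (by omega) y
  have c0 := coef_zero _ _ hb ha n
  have c1 := coef_succ _ _ hb ha n
  have hz := pjc_zero (-(h : ℂ) + 1 / 2 - Complex.I * μ) (-2 * h) (n + 1) (n + 2) (by omega)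
  have hd : deriv (fun y => pseudoJacobiPoly h μ (n + 1) y) η = (-2 * Complex.I) ^ (n + 1) *
      ∑ k ∈ Finset.range (n + 3), pjc (-(h : ℂ) + 1 / 2 - Complex.I * μ) (-2 * h) (n + 1) k *
        (k * ((1 - Complex.I * η) / 2) ^ (k - 1) * (-Complex.I / 2)) := by
    rw [hP1]
    apply HasDerivAt.deriv
    apply HasDerivAt.const_mul
    apply HasDerivAt.fun_sum
    intro k _
    apply HasDerivAt.const_mul
    apply HasDerivAt.fun_pow
    have := (((hasDerivAt_id η).const_mul Complex.I).const_sub 1).div_const 2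
    simpa using this
  rw [hd, pj_eq h μ (n + 1) (n + 3) (by omega), pj_eq h μ (n + 2) (n + 3) (by omega),
    pj_eq h μ n (n + 3) (by omega)]
  have hA : 4 * (μ : ℂ) * (2 * (h : ℂ) - n - 1) /
      ((2 * (h : ℂ) - 2 * n - 1) * (2 * (h : ℂ) - 2 * n - 3)) * (2 * Complex.I) =
      -(4 * (-2 * (h : ℂ) + 1 - 2 * (-(h : ℂ) + 1 / 2 - Complex.I * μ)) * (-2 * (h : ℂ) + n + 1) /
      ((-2 * (h : ℂ) + 2 * n + 1) * (-2 * (h : ℂ) + 2 * n + 3))) := by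
    rw [show (2 * (h : ℂ) - 2 * n - 1) * (2 * (h : ℂ) - 2 * n - 3) =
      (-2 * (h : ℂ) + 2 * n + 1) * (-2 * (h : ℂ) + 2 * n + 3) by ring]
    ring
  have hB : (2 * (h : ℂ) - n - 1) * (2 * (h : ℂ) - n) *
      ((2 * (h : ℂ) - 2 * n - 1) ^ 2 + 4 * (μ : ℂ) ^ 2) /
      (4 * ((h : ℂ) - n - 1) * ((h : ℂ) - n) * (2 * (h : ℂ) - 2 * n - 1) ^ 2) =
      4 * (-2 * (h : ℂ) + n + 1) * (-2 * (h : ℂ) + n) *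
      (n + (-(h : ℂ) + 1 / 2 - Complex.I * μ)) *
      (n + 1 + -2 * (h : ℂ) - (-(h : ℂ) + 1 / 2 - Complex.I * μ)) /
      ((-2 * (h : ℂ) + 2 * n + 2) * (-2 * (h : ℂ) + 2 * n) * (-2 * (h : ℂ) + 2 * n + 1) ^ 2) := by
    rw [show (4 * ((h : ℂ) - n - 1) * ((h : ℂ) - n) * (2 * (h : ℂ) - 2 * n - 1) ^ 2) =
      (-2 * (h : ℂ) + 2 * n + 2) * (-2 * (h : ℂ) + 2 * n) * (-2 * (h : ℂ) + 2 * n + 1) ^ 2 by ring]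
    congr 1
    linear_combination (4 * (2 * (h : ℂ) - n - 1) * (2 * (h : ℂ) - n) * (μ : ℂ) ^ 2) *
      Complex.I_sq
  rw [hB]
  generalize 4 * (μ : ℂ) * (2 * (h : ℂ) - n - 1) /
      ((2 * (h : ℂ) - 2 * n - 1) * (2 * (h : ℂ) - 2 * n - 3)) = A at *
  generalize 4 * (-2 * (h : ℂ) + 1 - 2 * (-(h : ℂ) + 1 / 2 - Complex.I * μ)) *
    (-2 * (h : ℂ) + n + 1) / ((-2 * (h : ℂ) + 2 * n + 1) * (-2 * (h : ℂ) + 2 * n + 3)) = A' at *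
  generalize 4 * (-2 * (h : ℂ) + n + 1) * (-2 * (h : ℂ) + n) *
      (n + (-(h : ℂ) + 1 / 2 - Complex.I * μ)) *
      (n + 1 + -2 * (h : ℂ) - (-(h : ℂ) + 1 / 2 - Complex.I * μ)) /
      ((-2 * (h : ℂ) + 2 * n + 2) * (-2 * (h : ℂ) + 2 * n) *
        (-2 * (h : ℂ) + 2 * n + 1) ^ 2) = B at *
  clear hB hd hP1
  generalize -(h : ℂ) + 1 / 2 - Complex.I * μ = a at *
  generalize (-2 * h : ℂ) = b at *
  have hx : 1 + η ^ 2 = 4 * ((1 - Complex.I * η) / 2) * (1 - (1 - Complex.I * η) / 2) := by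
    linear_combination η ^ 2 * Complex.I_sq
  rw [hx]
  generalize (1 - Complex.I * η) / 2 = x
  have key : -4 * (1 - x) * (x * ∑ k ∈ Finset.range (n + 3),
        pjc a b (n + 1) k * (k * x ^ (k - 1))) =
      (n + 1) * (-4 * ∑ k ∈ Finset.range (n + 3), pjc a b (n + 2) k * x ^ k
        - A' * ∑ k ∈ Finset.range (n + 3), pjc a b (n + 1) k * x ^ k
        + B * ∑ k ∈ Finset.range (n + 3), pjc a b n k * x ^ k) := by
    have t1 : x * ∑ k ∈ Finset.range (n + 3), pjc a b (n + 1) k * (k * x ^ (k - 1)) =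
        ∑ j ∈ Finset.range (n + 2), (j + 1) * pjc a b (n + 1) (j + 1) * x ^ (j + 1) := by
      rw [Finset.sum_range_succ']
      simp only [Nat.cast_zero, zero_mul, mul_zero, add_zero, Finset.mul_sum]
      refine Finset.sum_congr rfl fun j _ => ?_
      rw [Nat.add_sub_cancel]; push_cast; ring
    have t2 : x * ∑ k ∈ Finset.range (n + 3), pjc a b (n + 1) k * (k * x ^ (k - 1)) =
        ∑ j ∈ Finset.range (n + 2), j * pjc a b (n + 1) j * x ^ j := by
      rw [Finset.sum_range_succ, hz, zero_mul, add_zero, Finset.mul_sum]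
      refine Finset.sum_congr rfl fun j _ => ?_
      rcases j with _ | j
      · simp
      · rw [Nat.add_sub_cancel]; ring
    have t3 : -4 * (1 - x) * (x * ∑ k ∈ Finset.range (n + 3),
        pjc a b (n + 1) k * (k * x ^ (k - 1))) =
        ∑ j ∈ Finset.range (n + 2), (-4 * ((j + 1) * pjc a b (n + 1) (j + 1) -
          j * pjc a b (n + 1) j)) * x ^ (j + 1) := by
      calc _ = -4 * ((∑ j ∈ Finset.range (n + 2),
              (j + 1) * pjc a b (n + 1) (j + 1) * x ^ (j + 1)) -
            x * ∑ j ∈ Finset.range (n + 2), j * pjc a b (n + 1) j * x ^ j) := by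
              rw [← t1, ← t2]; ring
        _ = _ := by
          rw [Finset.mul_sum, ← Finset.sum_sub_distrib, Finset.mul_sum]
          refine Finset.sum_congr rfl fun j _ => ?_
          ring
    rw [t3, Finset.sum_congr rfl fun j hj => by rw [c1 j (Finset.mem_range.mp hj)]]
    simp only [Finset.sum_range_succ' _ (n + 2), pow_zero, mul_one]
    have t4 : ∑ j ∈ Finset.range (n + 2), (n + 1) * (-4 * pjc a b (n + 2) (j + 1)
        - A' * pjc a b (n + 1) (j + 1) + B * pjc a b n (j + 1)) * x ^ (j + 1) =
        (n + 1) * (-4 * ∑ j ∈ Finset.range (n + 2), pjc a b (n + 2) (j + 1) * x ^ (j + 1)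
          - A' * ∑ j ∈ Finset.range (n + 2), pjc a b (n + 1) (j + 1) * x ^ (j + 1)
          + B * ∑ j ∈ Finset.range (n + 2), pjc a b n (j + 1) * x ^ (j + 1)) := by
      simp only [Finset.mul_sum, ← Finset.sum_sub_distrib, ← Finset.sum_add_distrib]
      refine Finset.sum_congr rfl fun j _ => ?_
      ring
    rw [t4]
    linear_combination -((n : ℂ) + 1) * c0
  have hs : ∑ k ∈ Finset.range (n + 3), pjc a b (n + 1) k * (k * x ^ (k - 1) * (-Complex.I / 2))
      = (∑ k ∈ Finset.range (n + 3), pjc a b (n + 1) k * (k * x ^ (k - 1))) *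
        (-Complex.I / 2) := by
    rw [Finset.sum_mul]
    refine Finset.sum_congr rfl fun j _ => ?_
    ring
  rw [hs, pow_succ (_) (n + 1), pow_succ]
  generalize ∑ k ∈ Finset.range (n + 3), pjc a b (n + 1) k * (k * x ^ (k - 1)) = S at *
  generalize ∑ k ∈ Finset.range (n + 3), pjc a b (n + 1) k * x ^ k = S1 at *
  generalize ∑ k ∈ Finset.range (n + 3), pjc a b (n + 2) k * x ^ k = S2 at *
  generalize ∑ k ∈ Finset.range (n + 3), pjc a b n k * x ^ k = S0 at *
  generalize (-2 * Complex.I) ^ n = W at *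
  linear_combination W * key - W * (n + 1) * S1 * hA +
    W * (4 * x * (1 - x) * S - 4 * (n + 1) * S2) * Complex.I_sq
end
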